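/- Let T be a compact H-operator with constant C on an infinite-dimensional complex Banach space X, and let (λ_n(T))_{n≥1} be an enumeration of its eigenvalues ordered by nonincreasing modulus and counted with algebraic multiplicity. Then for any 0 < μ ≤ ∞ the following are equivalent: (|λ_n(T)|)_{n≥1} ∈ ℓ_μ, (δ_n(T))_{n≥0} ∈ ℓ_μ, and (α_n(T))_{n≥1} ∈ ℓ_μ. -/

import Mathlib

open scoped ENNReal

section Defs

variable {X Y : Type*} [NormedAddCommGroup X] [NormedSpace ℂ X]
  [NormedAddCommGroup Y] [NormedSpace ℂ Y]

/-- `approxNumber T n` is the `(n+1)`-st approximation number `α_{n+1}(T)`, i.e. the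
distance of `T` to the operators of rank `≤ n`. -/
noncomputable def approxNumber (T : X →L[ℂ] Y) (n : ℕ) : ℝ :=
  sInf {c : ℝ | ∃ A : X →L[ℂ] Y, Module.rank ℂ (LinearMap.range (A : X →ₗ[ℂ] Y)) ≤ (n : Cardinal) ∧
    c = ‖T - A‖}

/-- The canonical quotient map `X → X ⧸ G` as a continuous linear map. -/
noncomputable def quotMapL (G : Submodule ℂ X) : X →L[ℂ] X ⧸ G :=
  G.mkQ.mkContinuous 1 fun x => by
    simpa using Submodule.Quotient.norm_mk_le G x

/-- `kolmogorovDiameter T n` is the `n`-th Kolmogorov diameter `δ_n(T)` of an operator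
`T : X → X`: the infimum of `‖Q_G ∘ T‖` over subspaces `G ⊆ X` with `dim G ≤ n`. -/
noncomputable def kolmogorovDiameter (T : X →L[ℂ] X) (n : ℕ) : ℝ :=
  sInf {c : ℝ | ∃ G : Submodule ℂ X, Module.rank ℂ G ≤ (n : Cardinal) ∧
    c = ‖(quotMapL G).comp T‖}

/-- `T` is an H-operator with constant `C`: its spectrum is real and
`‖(T - λI)⁻¹‖ ≤ C * |Im λ|⁻¹` whenever `Im λ ≠ 0`. -/
def IsHOperator (T : X →L[ℂ] X) (C : ℝ) : Prop :=
  (∀ z ∈ spectrum ℂ T, z.im = 0) ∧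
  ∀ lam : ℂ, lam.im ≠ 0 →
    ∃ S : X →L[ℂ] X, S.comp (T - lam • (1 : X →L[ℂ] X)) = 1 ∧
      (T - lam • (1 : X →L[ℂ] X)).comp S = 1 ∧ ‖S‖ ≤ C * |lam.im|⁻¹

/-- The algebraic multiplicity of `μ` for `T`: the dimension of
`⋃_k ker (T - μI)^k`. -/
noncomputable def algebraicMultiplicity (T : X →L[ℂ] X) (μ : ℂ) : ℕ :=
  Module.finrank ℂ
    (⨆ k : ℕ, LinearMap.ker (((T - μ • (1 : X →L[ℂ] X)) ^ k : X →L[ℂ] X) : X →ₗ[ℂ] X) : Submodule ℂ X)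

/-- `lam` enumerates the eigenvalues of the compact operator `T` in order of
nonincreasing modulus, counted with algebraic multiplicity: `|lam 0| ≥ |lam 1| ≥ ⋯`,
each term is zero or a spectral value, every nonzero `μ` occurs exactly
`d(μ) = dim ⋃_k ker (T - μI)^k` times (in particular `lam n = 0` for the remaining
indices if there are only finitely many nonzero eigenvalues), and every nonzero
point of the spectrum occurs.  Here `lam n` stands for `λ_{n+1}(T)`. -/
def IsEigenvalueEnumeration (T : X →L[ℂ] X) (lam : ℕ → ℂ) : Prop :=
  (∀ n : ℕ, ‖lam (n + 1)‖ ≤ ‖lam n‖) ∧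
  (∀ n : ℕ, lam n = 0 ∨ lam n ∈ spectrum ℂ T) ∧
  (∀ μ : ℂ, μ ≠ 0 →
    {n : ℕ | lam n = μ}.Finite ∧ {n : ℕ | lam n = μ}.ncard = algebraicMultiplicity T μ) ∧
  (∀ μ ∈ spectrum ℂ T, μ ≠ 0 → ∃ n : ℕ, lam n = μ)

end Defs

/-- Membership of a real sequence in `ℓ_μ` for `0 < μ ≤ ∞`: summability of `|c n| ^ μ`
for finite `μ`, boundedness for `μ = ∞`. -/
def MemEllMu (μ : ℝ≥0∞) (c : ℕ → ℝ) : Prop :=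
  if μ = ∞ then ∃ M : ℝ, ∀ n : ℕ, |c n| ≤ M
  else Summable fun n : ℕ => |c n| ^ μ.toReal

section Packing

open MeasureTheory Metric Module

variable {E : Type*} [NormedAddCommGroup E] [NormedSpace ℝ E] [FiniteDimensional ℝ E]

theorem card_le_pow_finrank_of_separated {R : ℝ} (hR : 0 ≤ R) (s : Finset E)
    (hs : ∀ c ∈ s, ‖c‖ ≤ R) (h : ∀ c ∈ s, ∀ d ∈ s, c ≠ d → 1 / 2 ≤ ‖c - d‖) :
    (s.card : ℝ) ≤ (4 * R + 1) ^ finrank ℝ E := by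
  borelize E
  let ν : Measure E := Measure.addHaar
  have hdisj : Set.Pairwise (s : Set E) (Function.onFun Disjoint fun c => ball c (1 / 4 : ℝ)) := by
    rintro c hc d hd hcd
    apply ball_disjoint_ball
    rw [dist_eq_norm]
    linarith [h c hc d hd hcd]
  have hsub : (⋃ c ∈ s, ball c (1 / 4 : ℝ)) ⊆ ball (0 : E) (R + 1 / 4) := by
    refine Set.iUnion₂_subset fun x hx => ball_subset_ball' ?_
    rw [dist_zero_right]
    linarith [hs x hx]
  have hvol : (s.card : ℝ≥0∞) * ENNReal.ofReal ((1 / 4) ^ finrank ℝ E) * ν (ball 0 1) ≤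
      ENNReal.ofReal ((R + 1 / 4) ^ finrank ℝ E) * ν (ball 0 1) := by
    have := measure_mono (μ := ν) hsub
    rw [measure_biUnion_finset hdisj fun c _ => measurableSet_ball] at this
    simpa only [ν.addHaar_ball_of_pos _ (by norm_num : (0 : ℝ) < 1 / 4),
      ν.addHaar_ball_of_pos _ (by linarith : (0 : ℝ) < R + 1 / 4), Finset.sum_const, nsmul_eq_mul,
      mul_assoc] using this
  have hcard := (ENNReal.mul_le_mul_iff_left (measure_ball_pos ν _ zero_lt_one).ne'
    measure_ball_lt_top.ne).1 hvol
  have := ENNReal.toReal_le_of_le_ofReal (by positivity) hcard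
  rw [ENNReal.toReal_mul, ENNReal.toReal_natCast, ENNReal.toReal_ofReal (by positivity)] at this
  calc (s.card : ℝ) = s.card * (1 / 4) ^ finrank ℝ E * 4 ^ finrank ℝ E := by
        rw [mul_assoc, ← mul_pow]; norm_num
    _ ≤ (R + 1 / 4) ^ finrank ℝ E * 4 ^ finrank ℝ E := by gcongr
    _ = (4 * R + 1) ^ finrank ℝ E := by rw [← mul_pow]; ring_nf

theorem exists_separated_pow_finrank_le_card {R : ℝ} (hR : 0 < R) :
    ∃ s : Finset E, (∀ c ∈ s, ‖c‖ ≤ R) ∧ (∀ c ∈ s, ∀ d ∈ s, c ≠ d → 1 ≤ ‖c - d‖) ∧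
      R ^ finrank ℝ E ≤ s.card := by
  classical
  borelize E
  let ν : Measure E := Measure.addHaar
  let K : Set ℕ := {k | ∃ s : Finset E, (∀ c ∈ s, ‖c‖ ≤ R) ∧
    (∀ c ∈ s, ∀ d ∈ s, c ≠ d → 1 ≤ ‖c - d‖) ∧ s.card = k}
  have hbdd : BddAbove K := by
    refine ⟨⌊(4 * R + 1) ^ finrank ℝ E⌋₊, ?_⟩
    rintro k ⟨s, hs, h, rfl⟩
    refine Nat.le_floor (card_le_pow_finrank_of_separated hR.le s hs fun c hc d hd hcd => ?_)
    linarith [h c hc d hd hcd]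
  obtain ⟨s, hs, hsep, hcard⟩ := Nat.sSup_mem (s := K) ⟨0, ∅, by simp⟩ hbdd
  refine ⟨s, hs, hsep, ?_⟩
  have hcover : ball (0 : E) R ⊆ ⋃ c ∈ s, ball c (1 : ℝ) := by
    intro x hx
    by_contra hxs
    simp only [Set.mem_iUnion, mem_ball, dist_eq_norm, exists_prop, not_exists, not_and,
      not_lt] at hxs
    have hx_mem : x ∉ s := fun hmem => by
      have := hxs x hmem
      simp at this
      linarith
    have hinsert : (insert x s).card ∈ K := by
      refine ⟨insert x s, ?_, ?_, rfl⟩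
      · intro c hc
        rcases Finset.mem_insert.1 hc with rfl | hc
        · simpa using (mem_ball_zero_iff.1 hx).le
        · exact hs c hc
      · intro c hc d hd hcd
        rcases Finset.mem_insert.1 hc with rfl | hc' <;>
          rcases Finset.mem_insert.1 hd with rfl | hd'
        · exact absurd rfl hcd
        · exact hxs d hd'
        · rw [norm_sub_rev]; exact hxs c hc'
        · exact hsep c hc' d hd' hcd
    have := le_csSup hbdd hinsert
    rw [Finset.card_insert_of_notMem hx_mem] at this
    lia
  have hvol : ENNReal.ofReal (R ^ finrank ℝ E) * ν (ball 0 1) ≤ s.card * ν (ball 0 1) := by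
    rw [← ν.addHaar_ball_of_pos 0 hR]
    calc ν (ball 0 R) ≤ ν (⋃ c ∈ s, ball c (1 : ℝ)) := measure_mono hcover
      _ ≤ ∑ c ∈ s, ν (ball c (1 : ℝ)) := measure_biUnion_finset_le _ _
      _ = s.card * ν (ball 0 1) := by
        simp [Measure.addHaar_ball_center]
  have := (ENNReal.mul_le_mul_iff_left (measure_ball_pos ν _ zero_lt_one).ne'
    measure_ball_lt_top.ne).1 hvol
  simpa using (ENNReal.ofReal_le_iff_le_toReal (by simp)).1 this

/-- A subspace all of whose vectors are close to an `n`-dimensional subspace has dimension at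
most `2 * n`. -/
theorem finrank_le_two_mul_of_forall_exists_norm_sub_le {X : Type*} [NormedAddCommGroup X]
    [NormedSpace ℝ X] (E G : Submodule ℝ X) [FiniteDimensional ℝ E] [FiniteDimensional ℝ G]
    (h : ∀ y ∈ E, ‖y‖ ≤ 5 → ∃ g ∈ G, ‖y - g‖ ≤ 1 / 4) :
    finrank ℝ E ≤ 2 * finrank ℝ G := by
  classical
  obtain ⟨s, hs, hsep, hcard⟩ := exists_separated_pow_finrank_le_card (E := E)
    (by norm_num : (0 : ℝ) < 5)
  have happrox : ∀ y : E, ∃ g : G, ‖y‖ ≤ 5 → ‖(y : X) - g‖ ≤ 1 / 4 := fun y => by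
    by_cases hy : ‖y‖ ≤ 5
    · obtain ⟨g, hg, hyg⟩ := h y y.2 hy
      exact ⟨⟨g, hg⟩, fun _ => hyg⟩
    · exact ⟨0, fun h' => absurd h' hy⟩
  choose φ hφ using happrox
  have hφsep : ∀ c ∈ s, ∀ d ∈ s, c ≠ d → 1 / 2 ≤ ‖φ c - φ d‖ := by
    intro c hc d hd hcd
    have h1 := hsep c hc d hd hcd
    have h2 := hφ c (hs c hc)
    have h3 := hφ d (hs d hd)
    have h4 : ‖c - d‖ ≤ ‖(c : X) - φ c‖ + ‖φ c - φ d‖ + ‖(d : X) - φ d‖ := by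
      calc ‖c - d‖ = ‖((c : X) - φ c) + ((φ c : X) - φ d) - ((d : X) - φ d)‖ := by
            rw [show ‖c - d‖ = ‖(c : X) - d‖ from rfl]; congr 1; abel
        _ ≤ _ := (norm_sub_le _ _).trans (add_le_add_left (norm_add_le _ _) _)
    linarith
  have hinj : Set.InjOn φ s := by
    intro c hc d hd hcd
    by_contra hne
    have := hφsep c hc d hd hne
    rw [hcd, sub_self, norm_zero] at this
    linarith
  have hcard' := card_le_pow_finrank_of_separated (R := 21 / 4) (by norm_num) (s.image φ)
    (by
      simp only [Finset.mem_image, forall_exists_index, and_imp, forall_apply_eq_imp_iff₂]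
      intro c hc
      have h1 := hs c hc
      have h2 := hφ c h1
      calc ‖φ c‖ = ‖(c : X) - ((c : X) - φ c)‖ := by simp
        _ ≤ ‖(c : X)‖ + ‖(c : X) - φ c‖ := norm_sub_le _ _
        _ ≤ 21 / 4 := by linarith [show ‖(c : X)‖ = ‖c‖ from rfl])
    (by
      simp only [Finset.mem_image, forall_exists_index, and_imp, forall_apply_eq_imp_iff₂]
      exact fun c hc d hd hcd => hφsep c hc d hd fun h => hcd (by rw [h]))
  rw [Finset.card_image_of_injOn hinj] at hcard'
  have hpow : (5 : ℝ) ^ finrank ℝ E ≤ 5 ^ (2 * finrank ℝ G) :=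
    calc (5 : ℝ) ^ finrank ℝ E ≤ (4 * (21 / 4) + 1) ^ finrank ℝ G := hcard.trans hcard'
      _ ≤ 25 ^ finrank ℝ G := by gcongr; norm_num
      _ = 5 ^ (2 * finrank ℝ G) := by rw [pow_mul]; norm_num
  exact (pow_le_pow_iff_right₀ (by norm_num)).1 hpow

end Packing

section HOperator

open Module Complex

variable {X : Type*} [NormedAddCommGroup X] [NormedSpace ℂ X] {T : X →L[ℂ] X} {C : ℝ}

theorem norm_sq_sub_sq_of_norm_eq {z : ℂ} {ρ : ℝ} (hz : ‖z‖ = ρ) :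
    ‖z ^ 2 - (ρ : ℂ) ^ 2‖ = 2 * ρ * |z.im| := by
  have h : z ^ 2 - (ρ : ℂ) ^ 2 = z * (2 * z.im * I) := by
    have h1 : (ρ : ℂ) ^ 2 = z * (starRingEnd ℂ) z := by
      rw [mul_conj, normSq_eq_norm_sq, hz]; push_cast; rfl
    rw [h1, show (2 * z.im * I : ℂ) = z - (starRingEnd ℂ) z by rw [sub_conj]; push_cast; ring]
    ring
  rw [h]
  simp [hz]
  ring

theorem IsHOperator.sub_smul_apply_eq_zero (hH : IsHOperator T C) {a : ℂ} {x : X}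
    (h : (T - a • (1 : X →L[ℂ] X)) ((T - a • (1 : X →L[ℂ] X)) x) = 0) :
    (T - a • (1 : X →L[ℂ] X)) x = 0 := by
  set y := (T - a • (1 : X →L[ℂ] X)) x with hy
  by_cases ha : a.im = 0
  · have key : ∀ ε : ℝ, 0 < ε → ‖y‖ ≤ ε * ((1 + C) * ‖x‖) := by
      intro ε hε
      obtain ⟨S, hS, -, hSn⟩ := hH.2 (a + ε * I) (by simpa [ha] using hε.ne')
      have hSx := congr($hS x)
      have hSy := congr($hS y)
      have hshift (v : X) : (T - (a + ε * I) • (1 : X →L[ℂ] X)) v =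
          (T - a • (1 : X →L[ℂ] X)) v - (ε * I : ℂ) • v := by
        simp [add_smul, sub_sub]
      simp only [ContinuousLinearMap.comp_apply, hshift, ← hy, h, zero_sub, map_sub, map_neg, map_smul,
        one_apply_eq_self] at hSx hSy
      have hyx : y = - ((ε * I : ℂ) • x) + ((ε : ℂ) ^ 2) • S x := by
        rw [← hSy, sub_eq_iff_eq_add.1 hSx, smul_add, smul_smul,
          show (ε * I * (ε * I) : ℂ) = - (ε : ℂ) ^ 2 by linear_combination (ε : ℂ) ^ 2 * I_sq,
          neg_smul]
        abel
      have hSx' : ‖S x‖ ≤ C * ε⁻¹ * ‖x‖ := by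
        refine (S.le_opNorm x).trans ?_
        gcongr
        simpa [ha, abs_of_pos hε] using hSn
      calc ‖y‖ ≤ ‖(ε * I : ℂ) • x‖ + ‖((ε : ℂ) ^ 2) • S x‖ := by
            rw [hyx]; exact (norm_add_le _ _).trans (by rw [norm_neg])
        _ = ε * ‖x‖ + ε ^ 2 * ‖S x‖ := by simp [norm_smul, abs_of_pos hε]
        _ ≤ ε * ‖x‖ + ε ^ 2 * (C * ε⁻¹ * ‖x‖) := by gcongr
        _ = ε * ((1 + C) * ‖x‖) := by field_simp
    have hlim : Filter.Tendsto (fun ε : ℝ => ε * ((1 + C) * ‖x‖))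
        (nhdsWithin 0 (Set.Ioi 0)) (nhds 0) := by
      have : Filter.Tendsto (fun ε : ℝ => ε * ((1 + C) * ‖x‖)) (nhds 0)
          (nhds (0 * ((1 + C) * ‖x‖))) := (continuous_id.mul continuous_const).tendsto 0
      rw [zero_mul] at this
      exact this.mono_left nhdsWithin_le_nhds
    have := ge_of_tendsto hlim (Filter.eventually_of_mem self_mem_nhdsWithin key)
    exact norm_le_zero_iff.1 this
  · obtain ⟨S, hS, -⟩ := hH.2 a ha
    have hSy := congr($hS y)
    simpa only [ContinuousLinearMap.comp_apply, h, map_zero, one_apply_eq_self,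
      eq_comm] using hSy

theorem IsHOperator.algebraicMultiplicity_eq (hH : IsHOperator T C) (a : ℂ) :
    algebraicMultiplicity T a = finrank ℂ (End.eigenspace (T : End ℂ X) a) := by
  have hmem (x : X) : x ∈ End.eigenspace (T : End ℂ X) a ↔
      (T - a • (1 : X →L[ℂ] X)) x = 0 := by
    rw [End.mem_eigenspace_iff]
    simp [sub_eq_zero]
  have hpow : ∀ k : ℕ, ∀ x, ((T - a • (1 : X →L[ℂ] X)) ^ k) x = 0 →
      (T - a • (1 : X →L[ℂ] X)) x = 0 := by
    intro k
    induction k with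
    | zero => intro x hx; simp only [pow_zero, one_apply_eq_self] at hx; simp [hx]
    | succ k ih =>
      intro x hx
      rw [pow_succ] at hx
      exact hH.sub_smul_apply_eq_zero (ih _ hx)
  have hsup : (⨆ k : ℕ, LinearMap.ker (((T - a • (1 : X →L[ℂ] X)) ^ k : X →L[ℂ] X) :
      X →ₗ[ℂ] X) : Submodule ℂ X) = End.eigenspace (T : End ℂ X) a := by
    apply le_antisymm
    · exact iSup_le fun k x hx => (hmem x).2 (hpow k x hx)
    · refine le_trans (fun x hx => ?_) (le_iSup _ 1)
      rw [LinearMap.mem_ker, pow_one]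
      exact (hmem x).1 hx
  rw [algebraicMultiplicity, hsup]

theorem IsHOperator.norm_sum_le (hH : IsHOperator T C) {r : ℝ} (hr : 0 < r) {Λ : Finset ℂ}
    (hΛ : ∀ a ∈ Λ, r ≤ ‖a‖) {x : ℂ → X} (hx : ∀ a ∈ Λ, T (x a) = a • x a) :
    ‖∑ a ∈ Λ, x a‖ ≤ 4 * C / r * ‖T (∑ a ∈ Λ, x a)‖ := by
  set y := T (∑ a ∈ Λ, x a) with hy
  set ρ : ℝ := r / 2 with hρ
  have hρ0 : 0 < ρ := by positivity
  let g : ℂ → X := fun z => ∑ a ∈ Λ, (a / (a - z)) • x a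
  have hne : ∀ a ∈ Λ, ∀ z ∈ Metric.closedBall (0 : ℂ) ρ, a - z ≠ 0 := by
    intro a ha z hz h
    have := hΛ a ha
    rw [sub_eq_zero.1 h] at this
    have := mem_closedBall_zero_iff.1 hz
    linarith
  have hdiff : DifferentiableOn ℂ (fun z => (z ^ 2 - (ρ : ℂ) ^ 2) • g z)
      (Metric.closedBall 0 ρ) := by
    refine DifferentiableOn.smul (by fun_prop) (DifferentiableOn.fun_sum fun a ha => ?_)
    refine DifferentiableOn.smul_const (DifferentiableOn.div (by fun_prop) (by fun_prop) ?_) _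
    exact hne a ha
  have hbound : ∀ z ∈ frontier (Metric.ball (0 : ℂ) ρ),
      ‖(z ^ 2 - (ρ : ℂ) ^ 2) • g z‖ ≤ 2 * ρ * C * ‖y‖ := by
    intro z hz
    rw [frontier_ball _ hρ0.ne', mem_sphere_zero_iff_norm] at hz
    rw [norm_smul, norm_sq_sub_sq_of_norm_eq hz]
    by_cases him : z.im = 0
    · obtain ⟨S, -, -, hS⟩ := hH.2 I (by simp)
      have hC : 0 ≤ C := by simpa using (norm_nonneg _).trans hS
      simp only [him, abs_zero, mul_zero, zero_mul]
      positivity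
    obtain ⟨S, hS, -, hSn⟩ := hH.2 z him
    have hg : (T - z • (1 : X →L[ℂ] X)) (g z) = y := by
      simp only [g, hy, map_sum, map_smul]
      refine Finset.sum_congr rfl fun a ha => ?_
      have := hne a ha z (mem_closedBall_zero_iff.2 hz.le)
      simp only [sub_apply, smul_apply,
        one_apply_eq_self, hx a ha]
      rw [← sub_smul, smul_smul, div_mul_cancel₀ _ this]
    have hgS : g z = S y := by
      rw [← hg, ← ContinuousLinearMap.comp_apply, hS, one_apply_eq_self]
    have him' : 0 < |z.im| := abs_pos.2 him
    calc 2 * ρ * |z.im| * ‖g z‖ ≤ 2 * ρ * |z.im| * (C * |z.im|⁻¹ * ‖y‖) := by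
          rw [hgS]
          gcongr
          exact (S.le_opNorm y).trans (by gcongr)
      _ = 2 * ρ * C * ‖y‖ := by field_simp
  have h0 := norm_le_of_forall_mem_frontier_norm_le Metric.isBounded_ball
    (hdiff.diffContOnCl_ball subset_rfl) hbound (subset_closure (Metric.mem_ball_self hρ0))
  have hg0 : g 0 = ∑ a ∈ Λ, x a := by
    refine Finset.sum_congr rfl fun a ha => ?_
    have := hne a ha 0 (Metric.mem_closedBall_self hρ0.le)
    rw [sub_zero] at this ⊢
    rw [div_self this, one_smul]
  rw [hg0, norm_smul] at h0
  have h1 : ρ * (ρ * ‖∑ a ∈ Λ, x a‖) ≤ ρ * (2 * C * ‖y‖) := by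
    calc _ = ‖(0 : ℂ) ^ 2 - (ρ : ℂ) ^ 2‖ * ‖∑ a ∈ Λ, x a‖ := by
          simp [abs_of_pos hρ0]; ring
      _ ≤ _ := h0
      _ = _ := by ring
  have h2 := le_of_mul_le_mul_left h1 hρ0
  rw [div_mul_eq_mul_div, le_div_iff₀ hr]
  rw [hρ] at h2
  linarith

/-- If `T` has more than `2 * n` eigenvalues of modulus at least `r`, then `δ_n(T)` is bounded
below by a multiple of `r`. -/
theorem IsHOperator.le_kolmogorovDiameter (hH : IsHOperator T C) (hC : 0 < C) {r : ℝ} (hr : 0 < r)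
    {Λ : Finset ℂ} (hΛ : ∀ a ∈ Λ, r ≤ ‖a‖) {n : ℕ}
    (hn : 2 * n < finrank ℂ (⨆ a ∈ Λ, End.eigenspace (T : End ℂ X) a : Submodule ℂ X)) :
    r / (80 * C) ≤ kolmogorovDiameter T n := by
  refine le_csInf ⟨_, ⊥, by simp, rfl⟩ ?_
  rintro _ ⟨G, hG, rfl⟩
  by_contra! hlt
  set E : Submodule ℂ X := ⨆ a ∈ Λ, End.eigenspace (T : End ℂ X) a with hE
  have : FiniteDimensional ℂ E := finite_of_finrank_pos (by lia)
  have : FiniteDimensional ℂ G := rank_lt_aleph0_iff.1 (hG.trans_lt Cardinal.natCast_lt_aleph0)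
  have hGn : finrank ℂ G ≤ n := finrank_le_of_rank_le hG
  have : FiniteDimensional ℝ (E.restrictScalars ℝ) := FiniteDimensional.complexToReal E
  have : FiniteDimensional ℝ (G.restrictScalars ℝ) := FiniteDimensional.complexToReal G
  have key := finrank_le_two_mul_of_forall_exists_norm_sub_le (E.restrictScalars ℝ)
    (G.restrictScalars ℝ) (fun y hy hy5 => by
      obtain ⟨v, hv, rfl⟩ := (Submodule.mem_iSup_finset_iff_exists_sum _ _).1 hy
      have hx : ∀ a ∈ Λ, T (a⁻¹ • (v a : X)) = a • a⁻¹ • (v a : X) := fun a _ => by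
        rw [map_smul, smul_comm]
        congr 1
        exact End.mem_eigenspace_iff.1 (v a).2
      have hTx : T (∑ a ∈ Λ, a⁻¹ • (v a : X)) = ∑ a ∈ Λ, (v a : X) := by
        rw [map_sum]
        refine Finset.sum_congr rfl fun a ha => ?_
        rw [hx a ha, smul_inv_smul₀ (norm_pos_iff.1 (hr.trans_le (hΛ a ha)))]
      have hnorm := hH.norm_sum_le hr hΛ hx
      rw [hTx] at hnorm
      have hquot : ‖(Submodule.Quotient.mk (∑ a ∈ Λ, (v a : X)) : X ⧸ G)‖ < 1 / 4 := by
        calc ‖(Submodule.Quotient.mk (∑ a ∈ Λ, (v a : X)) : X ⧸ G)‖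
            = ‖((quotMapL G).comp T) (∑ a ∈ Λ, a⁻¹ • (v a : X))‖ := by
              rw [ContinuousLinearMap.comp_apply, hTx]; rfl
          _ ≤ ‖(quotMapL G).comp T‖ * ‖∑ a ∈ Λ, a⁻¹ • (v a : X)‖ :=
              ContinuousLinearMap.le_opNorm _ _
          _ ≤ ‖(quotMapL G).comp T‖ * (4 * C / r * 5) := by
              gcongr
              exact hnorm.trans (by gcongr)
          _ < r / (80 * C) * (4 * C / r * 5) := by gcongr
          _ = 1 / 4 := by field_simp; norm_num
      obtain ⟨g, hg, hlt⟩ := (QuotientAddGroup.norm_lt_iff).1 hquot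
      refine ⟨∑ a ∈ Λ, (v a : X) - g, ?_, by simpa using hlt.le⟩
      exact (Submodule.Quotient.eq G).1 hg.symm)
  have h1 : finrank ℝ (E.restrictScalars ℝ) = 2 * finrank ℂ E := finrank_real_of_complex E
  have h2 : finrank ℝ (G.restrictScalars ℝ) = 2 * finrank ℂ G := finrank_real_of_complex G
  lia

end HOperator

section Contour

open Complex Real

variable {A : Type*} [NormedRing A] [NormedAlgebra ℂ A]

theorem isUnit_one_sub_smul_of_inv_notMem_spectrum {a : A} {s : ℂ} (hs : s ≠ 0)
    (h : s⁻¹ ∉ spectrum ℂ a) : IsUnit (1 - s • a) := by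
  rw [spectrum.notMem_iff] at h
  have : 1 - s • a = (Units.mk0 s hs) • (algebraMap ℂ A s⁻¹ - a) := by
    rw [Units.smul_def, Units.val_mk0, smul_sub, Algebra.algebraMap_eq_smul_one, smul_smul,
      mul_inv_cancel₀ hs, one_smul]
  rw [this]
  exact (isUnit_smul_iff _ _).2 h

/-- The contour integral which, on an operator with no spectrum on the circle of radius `ρ`,
takes the value `z` at the spectral points inside the circle and `ρ ^ 2 / z` at those outside. -/
noncomputable def contourTruncation (ρ : ℝ) (a : A) : A :=
  (2 * π * I : ℂ)⁻¹ • ∮ s in C(0, ρ⁻¹),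
    ((s - 0) ^ 2)⁻¹ • ((1 - (ρ : ℂ) ^ 2 * s ^ 2) • Ring.inverse (1 - s • a))

variable [CompleteSpace A]

theorem differentiableAt_inverse_one_sub_smul {a : A} {s : ℂ} (h : IsUnit (1 - s • a)) :
    DifferentiableAt ℂ (fun s : ℂ => Ring.inverse (1 - s • a)) s := by
  refine DifferentiableAt.comp s (g := Ring.inverse) (f := fun s : ℂ => 1 - s • a)
    (differentiableAt_inverse h) (by fun_prop)

theorem contourTruncation_eq_self {ρ : ℝ} (hρ : 0 < ρ) {a : A}
    (h : ∀ z ∈ spectrum ℂ a, ‖z‖ < ρ) : contourTruncation ρ a = a := by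
  have hunit : ∀ s ∈ Metric.closedBall (0 : ℂ) ρ⁻¹, IsUnit (1 - s • a) := by
    intro s hs
    by_cases hs0 : s = 0
    · simp [hs0]
    refine isUnit_one_sub_smul_of_inv_notMem_spectrum hs0 fun hmem => ?_
    have h1 := h _ hmem
    rw [norm_inv] at h1
    have h2 := mem_closedBall_zero_iff.1 hs
    exact absurd h1 (not_lt.2 ((le_inv_comm₀ (norm_pos_iff.2 hs0) hρ).1 h2))
  have hopen : IsOpen {s : ℂ | IsUnit (1 - s • a)} :=
    Units.isOpen.preimage (f := fun s : ℂ => 1 - s • a) (by fun_prop)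
  rw [contourTruncation, two_pi_I_inv_smul_circleIntegral_sub_sq_inv_smul_of_differentiable
    hopen hunit _ (Metric.mem_ball_self (inv_pos.2 hρ))]
  · have h1 : HasDerivAt (fun s : ℂ => 1 - s • a) (-a) 0 := by
      simpa using ((hasDerivAt_id (0 : ℂ)).smul_const a).const_sub 1
    have h2 : HasDerivAt (fun s : ℂ => Ring.inverse (1 - s • a)) a 0 := by
      have h3 : HasFDerivAt (Ring.inverse : A → A)
          (-ContinuousLinearMap.mulLeftRight ℂ A ↑(1 : Aˣ)⁻¹ ↑(1 : Aˣ)⁻¹) (1 - (0 : ℂ) • a) := by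
        simpa using hasFDerivAt_ringInverse (𝕜 := ℂ) (1 : Aˣ)
      simpa [Function.comp_def] using h3.comp_hasDerivAt (0 : ℂ) h1
    have h3 : HasDerivAt (fun s : ℂ => 1 - (ρ : ℂ) ^ 2 * s ^ 2) 0 0 := by
      simpa using ((hasDerivAt_pow 2 (0 : ℂ)).const_mul ((ρ : ℂ) ^ 2)).const_sub 1
    simpa using (h3.fun_smul h2).deriv
  · intro s hs
    have h1 : DifferentiableAt ℂ (fun s : ℂ => 1 - (ρ : ℂ) ^ 2 * s ^ 2) s := by fun_prop
    exact (h1.fun_smul (differentiableAt_inverse_one_sub_smul hs)).differentiableWithinAt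

theorem contourTruncation_circleIntegrable {ρ : ℝ} (hρ : 0 < ρ) {a : A}
    (h : ∀ z ∈ spectrum ℂ a, ‖z‖ ≠ ρ) : CircleIntegrable (fun s : ℂ =>
      ((s - 0) ^ 2)⁻¹ • ((1 - (ρ : ℂ) ^ 2 * s ^ 2) • Ring.inverse (1 - s • a))) 0 ρ⁻¹ := by
  refine ContinuousOn.circleIntegrable (inv_pos.2 hρ).le fun s hs => ?_
  have hs' : ‖s‖ = ρ⁻¹ := mem_sphere_zero_iff_norm.1 hs
  have hs0 : s ≠ 0 := norm_pos_iff.1 (hs' ▸ inv_pos.2 hρ)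
  have hunit : IsUnit (1 - s • a) :=
    isUnit_one_sub_smul_of_inv_notMem_spectrum hs0 fun hmem => h _ hmem (by simp [hs'])
  refine ContinuousAt.continuousWithinAt (ContinuousAt.smul ?_ (ContinuousAt.smul (by fun_prop)
    (differentiableAt_inverse_one_sub_smul hunit).continuousAt))
  exact ContinuousAt.inv₀ (by fun_prop) (by simpa using hs0)

theorem contourTruncation_mul {ρ : ℝ} (hρ : 0 < ρ) {a b q : A}
    (ha : ∀ z ∈ spectrum ℂ a, ‖z‖ ≠ ρ) (hb : ∀ z ∈ spectrum ℂ b, ‖z‖ ≠ ρ) (hq : a * q = q * b) :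
    contourTruncation ρ a * q = q * contourTruncation ρ b := by
  have hcongr : ∀ s ∈ Metric.sphere (0 : ℂ) ρ⁻¹,
      (((s - 0) ^ 2)⁻¹ • ((1 - (ρ : ℂ) ^ 2 * s ^ 2) • Ring.inverse (1 - s • a))) * q =
      q * (((s - 0) ^ 2)⁻¹ • ((1 - (ρ : ℂ) ^ 2 * s ^ 2) • Ring.inverse (1 - s • b))) := by
    intro s hs
    have hs' : ‖s‖ = ρ⁻¹ := mem_sphere_zero_iff_norm.1 hs
    have hs0 : s ≠ 0 := norm_pos_iff.1 (hs' ▸ inv_pos.2 hρ)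
    have hua : IsUnit (1 - s • a) :=
      isUnit_one_sub_smul_of_inv_notMem_spectrum hs0 fun hmem => ha _ hmem (by simp [hs'])
    have hub : IsUnit (1 - s • b) :=
      isUnit_one_sub_smul_of_inv_notMem_spectrum hs0 fun hmem => hb _ hmem (by simp [hs'])
    have key : Ring.inverse (1 - s • a) * q = q * Ring.inverse (1 - s • b) := by
      calc Ring.inverse (1 - s • a) * q
          = Ring.inverse (1 - s • a) * (q * (1 - s • b)) * Ring.inverse (1 - s • b) := by
            rw [mul_assoc, mul_assoc, Ring.mul_inverse_cancel _ hub, mul_one]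
        _ = Ring.inverse (1 - s • a) * ((1 - s • a) * q) * Ring.inverse (1 - s • b) := by
            rw [mul_sub, sub_mul, mul_smul_comm, smul_mul_assoc, hq, mul_one, one_mul]
        _ = q * Ring.inverse (1 - s • b) := by
            rw [← mul_assoc, Ring.inverse_mul_cancel _ hua, one_mul]
    simp only [smul_mul_assoc, mul_smul_comm, key]
  have h1 (f : ℂ → A) (hf : CircleIntegrable f 0 ρ⁻¹) (L : A →L[ℂ] A) :
      L (∮ s in C(0, ρ⁻¹), f s) = ∮ s in C(0, ρ⁻¹), L (f s) := by
    simp only [circleIntegral, ← map_smul]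
    exact (L.intervalIntegral_comp_comm hf.out).symm
  have ha' := h1 _ (contourTruncation_circleIntegrable hρ ha)
    ((ContinuousLinearMap.mul ℂ A).flip q)
  have hb' := h1 _ (contourTruncation_circleIntegrable hρ hb) (ContinuousLinearMap.mul ℂ A q)
  simp only [ContinuousLinearMap.flip_apply, ContinuousLinearMap.mul_apply'] at ha' hb'
  rw [contourTruncation, contourTruncation, smul_mul_assoc, mul_smul_comm, ha', hb',
    circleIntegral.integral_congr (inv_pos.2 hρ).le hcongr]

end Contour

section Approximation

open Module Complex

theorem finrank_biSup_eq_sum_of_iSupIndep {ι K V : Type*} [DivisionRing K] [AddCommGroup V]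
    [Module K V] {W : ι → Submodule K V} (hW : iSupIndep W) (s : Finset ι)
    (hfin : ∀ i ∈ s, FiniteDimensional K (W i)) :
    FiniteDimensional K (⨆ i ∈ s, W i : Submodule K V) ∧
      finrank K (⨆ i ∈ s, W i : Submodule K V) = ∑ i ∈ s, finrank K (W i) := by
  classical
  induction s using Finset.induction_on with
  | empty =>
    rw [show (⨆ i ∈ (∅ : Finset ι), W i) = ⊥ by simp]
    exact ⟨inferInstance, by simp⟩
  | insert i s hi ih =>
    obtain ⟨ih1, ih2⟩ := ih fun j hj => hfin j (Finset.mem_insert_of_mem hj)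
    have := hfin i (Finset.mem_insert_self i s)
    rw [Finset.iSup_insert, Finset.sum_insert hi, ← ih2]
    refine ⟨inferInstance, ?_⟩
    have hdisj : Disjoint (W i) (⨆ j ∈ s, W j) :=
      (hW i).mono_right (biSup_mono fun j hj => ne_of_mem_of_not_mem hj hi)
    rw [← Submodule.finrank_sup_add_finrank_inf_eq, hdisj.eq_bot, finrank_bot, add_zero]

variable {X : Type*} [NormedAddCommGroup X] [NormedSpace ℂ X] {T : X →L[ℂ] X} {C : ℝ}

/-- The spectral projection of a compact H-operator onto an eigenspace. -/
theorem IsHOperator.exists_eigenprojection [CompleteSpace X] (hH : IsHOperator T C)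
    (hT : IsCompactOperator T) {a : ℂ} (ha : a ≠ 0)
    (hfin : FiniteDimensional ℂ (End.eigenspace (T : End ℂ X) a)) :
    ∃ P : X →L[ℂ] X, (∀ x, P x ∈ End.eigenspace (T : End ℂ X) a) ∧ P * T = a • P ∧
      ∀ x ∈ End.eigenspace (T : End ℂ X) a, P x = x := by
  set N := End.eigenspace (T : End ℂ X) a with hN
  obtain ⟨p, hp⟩ := Submodule.ClosedComplemented.of_finiteDimensional N
  set π : X →L[ℂ] X := N.subtypeL ∘L p with hπ
  have hπN (x : X) : π x ∈ N := (p x).2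
  have hπid {x : X} (hx : x ∈ N) : π x = x := by
    simpa [hπ] using congr(($(hp ⟨x, hx⟩) : X))
  have hmem {x : X} : x ∈ N ↔ (T - a • (1 : X →L[ℂ] X)) x = 0 := by
    rw [hN, End.mem_eigenspace_iff]
    simp [sub_eq_zero]
  have hdisj {x : X} (hx : (T - a • (1 : X →L[ℂ] X)) x ∈ N) :
      (T - a • (1 : X →L[ℂ] X)) x = 0 := hH.sub_smul_apply_eq_zero (hmem.1 hx)
  have hcomp : IsCompactOperator (T + π : X →L[ℂ] X) := by
    have hπc : IsCompactOperator (π : X →L[ℂ] X) := by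
      have := FiniteDimensional.proper ℂ N
      exact (isCompactOperator_of_locallyCompactSpace_rng N.subtypeL).comp_clm p
    exact hT.add hπc
  have hres := (hcomp.hasEigenvalue_or_mem_resolventSet ha).resolve_left fun h => by
    obtain ⟨x, hx⟩ := h.exists_hasEigenvector
    refine hx.2 ?_
    have h1 : T x + π x = a • x := hx.apply_eq_smul
    have h2 : (T - a • (1 : X →L[ℂ] X)) x = - π x := by
      simp [← h1]
    have h3 := hdisj (h2 ▸ N.neg_mem (hπN x))
    rw [← hπid (hmem.2 h3), ← neg_eq_zero, ← h2, h3]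
  obtain ⟨V, hV1, hV2⟩ := isUnit_iff_exists.1 (spectrum.mem_resolventSet_iff.1 hres)
  rw [Algebra.algebraMap_eq_smul_one] at hV1 hV2
  have hV (y : X) : (T - a • (1 : X →L[ℂ] X)) (V y) + π (V y) = - y := by
    have := congr(-$hV1 y)
    simp at this
    rw [← this]
    simp
    abel
  refine ⟨-(π * V), fun x => N.neg_mem (hπN _), ?_, ?_⟩
  · have hzero (w : X) : π (V ((T - a • (1 : X →L[ℂ] X)) w)) = 0 := by
      set y := (T - a • (1 : X →L[ℂ] X)) w
      have h1 : (T - a • (1 : X →L[ℂ] X)) (V y + w) = - π (V y) := by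
        rw [map_add, eq_neg_iff_add_eq_zero]
        rw [← neg_add_cancel y, ← hV y]
        abel
      have h2 := hdisj (h1 ▸ N.neg_mem (hπN _))
      rw [← neg_eq_zero, ← h1, h2]
    ext w
    have := hzero w
    simp only [sub_apply, smul_apply, one_apply_eq_self, map_sub, map_smul, sub_eq_zero] at this
    simp [this]
  · intro x hx
    have h1 : V x = - x := by
      have := congr(-$hV2 x)
      have hTx : T x = a • x := End.mem_eigenspace_iff.1 hx
      simpa [hπid hx, hTx] using this
    simp [h1, hπid hx]

theorem IsHOperator.norm_contourTruncation_le (hH : IsHOperator T C) (hC : 0 ≤ C) {ρ : ℝ}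
    (hρ : 0 < ρ) : ‖contourTruncation ρ T‖ ≤ 2 * C * ρ := by
  have hbound : ∀ s ∈ Metric.sphere (0 : ℂ) ρ⁻¹,
      ‖((s - 0) ^ 2)⁻¹ • ((1 - (ρ : ℂ) ^ 2 * s ^ 2) • Ring.inverse (1 - s • T))‖ ≤
        2 * C * ρ ^ 2 := by
    intro s hs
    have hs' : ‖s‖ = ρ⁻¹ := mem_sphere_zero_iff_norm.1 hs
    have hs0 : s ≠ 0 := norm_pos_iff.1 (hs' ▸ inv_pos.2 hρ)
    have hz : ‖s⁻¹‖ = ρ := by rw [norm_inv, hs', inv_inv]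
    have hfac : ‖((s - 0) ^ 2)⁻¹ • ((1 - (ρ : ℂ) ^ 2 * s ^ 2) • Ring.inverse (1 - s • T))‖ =
        2 * ρ * |(s⁻¹).im| * ‖Ring.inverse (1 - s • T)‖ := by
      rw [smul_smul, norm_smul, ← norm_sq_sub_sq_of_norm_eq hz]
      congr 2
      field_simp
      simp
    rw [hfac]
    by_cases him : (s⁻¹).im = 0
    · rw [him]
      simp
      positivity
    obtain ⟨S, hS1, hS2, hSn⟩ := hH.2 _ him
    have h1 : (1 - s • T) = -s • (T - s⁻¹ • (1 : X →L[ℂ] X)) := by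
      rw [smul_sub, smul_smul, neg_mul, mul_inv_cancel₀ hs0]
      module
    have hinv : Ring.inverse (1 - s • T) = (-s)⁻¹ • S := by
      have h2 : (1 - s • T) * ((-s)⁻¹ • S) = 1 := by
        rw [h1, smul_mul_smul_comm, mul_inv_cancel₀ (neg_ne_zero.2 hs0), one_smul]
        exact hS2
      have h3 : ((-s)⁻¹ • S) * (1 - s • T) = 1 := by
        rw [h1, smul_mul_smul_comm, inv_mul_cancel₀ (neg_ne_zero.2 hs0), one_smul]
        exact hS1
      rw [← mul_one (Ring.inverse _), Ring.inverse_mul_eq_iff_eq_mul _ _ _ ⟨⟨_, _, h2, h3⟩, rfl⟩, h2]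
    rw [hinv, norm_smul, norm_inv, norm_neg, hs', inv_inv]
    calc 2 * ρ * |(s⁻¹).im| * (ρ * ‖S‖) ≤ 2 * ρ * |(s⁻¹).im| * (ρ * (C * |(s⁻¹).im|⁻¹)) := by gcongr
      _ = 2 * C * ρ ^ 2 := by
        linear_combination (2 * ρ ^ 2 * C) * mul_inv_cancel₀ (abs_ne_zero.2 him)
  calc ‖contourTruncation ρ T‖ ≤ ρ⁻¹ * (2 * C * ρ ^ 2) :=
        circleIntegral.norm_two_pi_i_inv_smul_integral_le_of_norm_le_const (inv_pos.2 hρ).le hbound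
    _ = 2 * C * ρ := by field_simp

/-- An approximant of `T` obtained by cutting off its eigenvalues of modulus at most `ρ`. -/
theorem IsHOperator.approxNumber_le [CompleteSpace X] (hH : IsHOperator T C) (hC : 0 ≤ C)
    (hT : IsCompactOperator T) {ρ : ℝ} (hρ : 0 < ρ) {Λ : Finset ℂ} (hΛ : ∀ a ∈ Λ, ρ < ‖a‖)
    (hspec : ∀ z ∈ spectrum ℂ T, ρ ≤ ‖z‖ → z ∈ Λ)
    (hfin : ∀ a ∈ Λ, FiniteDimensional ℂ (End.eigenspace (T : End ℂ X) a)) {n : ℕ}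
    (hn : finrank ℂ (⨆ a ∈ Λ, End.eigenspace (T : End ℂ X) a : Submodule ℂ X) ≤ n) :
    approxNumber T n ≤ 2 * C * ρ := by
  have hne : ∀ a ∈ Λ, a ≠ 0 := fun a ha => norm_pos_iff.1 (hρ.trans (hΛ a ha))
  have hex (a : ℂ) : ∃ P : X →L[ℂ] X, a ∈ Λ →
      (∀ x, P x ∈ End.eigenspace (T : End ℂ X) a) ∧ P * T = a • P ∧
      ∀ x ∈ End.eigenspace (T : End ℂ X) a, P x = x := by
    by_cases ha : a ∈ Λ
    · obtain ⟨P, hP⟩ := hH.exists_eigenprojection hT (hne a ha) (hfin a ha)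
      exact ⟨P, fun _ => hP⟩
    · exact ⟨0, fun h => absurd h ha⟩
  choose P hP using hex
  have hTP : ∀ a ∈ Λ, T * P a = a • P a := fun a ha => by
    ext x
    exact End.mem_eigenspace_iff.1 ((hP a ha).1 x)
  have hPP : ∀ a ∈ Λ, ∀ b ∈ Λ, P a * P b = if a = b then P a else 0 := by
    intro a ha b hb
    split_ifs with hab
    · subst hab
      ext x
      exact (hP a ha).2.2 _ ((hP a ha).1 x)
    · have h1 : (a - b) • (P a * P b) = 0 := by
        rw [sub_smul, ← smul_mul_assoc, ← (hP a ha).2.1, mul_assoc, hTP b hb, mul_smul_comm,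
          sub_self]
      exact (smul_eq_zero.1 h1).resolve_left (sub_ne_zero.2 hab)
  set Q : X →L[ℂ] X := ∑ a ∈ Λ, P a with hQ
  set R : X →L[ℂ] X := T - T * Q with hR
  have hQT : Q * T = T * Q := by
    rw [hQ, Finset.sum_mul, Finset.mul_sum]
    exact Finset.sum_congr rfl fun a ha => by rw [(hP a ha).2.1, hTP a ha]
  have hPQ : ∀ a ∈ Λ, P a * Q = P a := fun a ha => by
    rw [hQ, Finset.mul_sum, Finset.sum_congr rfl fun b hb => hPP a ha b hb]
    simp [ha]
  have hQQ : Q * Q = Q := by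
    conv_lhs => rw [hQ, Finset.sum_mul]
    exact Finset.sum_congr rfl hPQ
  have hQR : Q * R = 0 := by rw [hR, mul_sub, ← mul_assoc, hQT, mul_assoc, hQQ, sub_self]
  have hPR : ∀ a ∈ Λ, P a * R = 0 := fun a ha => by
    rw [← hPQ a ha, mul_assoc, hQR, mul_zero]
  have hRc : IsCompactOperator R := hT.sub (hT.comp_clm Q)
  have hRspec : ∀ z ∈ spectrum ℂ R, ‖z‖ < ρ := by
    intro z hz
    by_contra! hzρ
    have hz0 : z ≠ 0 := norm_pos_iff.1 (hρ.trans_le hzρ)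
    obtain ⟨x, hx⟩ := ((hRc.hasEigenvalue_iff_mem_spectrum hz0).2 hz).exists_hasEigenvector
    have hRx : R x = z • x := hx.apply_eq_smul
    have hPx (a : ℂ) (ha : a ∈ Λ) : P a x = 0 := by
      have h1 : P a (R x) = 0 := congr($(hPR a ha) x)
      rw [hRx, map_smul] at h1
      exact (smul_eq_zero.1 h1).resolve_left hz0
    have hQx : Q x = 0 := by
      rw [hQ, sum_apply]
      exact Finset.sum_eq_zero hPx
    have hTx : T x = z • x := by
      rw [← hRx]
      simp [hR, hQx]
    have hxT : End.HasEigenvector (T : End ℂ X) z x := ⟨End.mem_eigenspace_iff.2 hTx, hx.2⟩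
    have hzΛ : z ∈ Λ := hspec z
      ((hT.hasEigenvalue_iff_mem_spectrum hz0).1 (End.hasEigenvalue_of_hasEigenvector hxT)) hzρ
    exact hx.2 (((hP z hzΛ).2.2 x hxT.1).symm.trans (hPx z hzΛ))
  have hTspec : ∀ z ∈ spectrum ℂ T, ‖z‖ ≠ ρ := fun z hz h =>
    (hΛ z (hspec z hz h.ge)).ne' h
  have hcomm : T * (1 - Q) = (1 - Q) * R := by
    rw [sub_mul, hQR, one_mul, sub_zero, mul_sub, mul_one]
  have hB := contourTruncation_mul hρ hTspec (fun z hz => (hRspec z hz).ne) hcomm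
  rw [contourTruncation_eq_self hρ hRspec, ← hcomm] at hB
  set B := contourTruncation ρ T
  have hTB : T - B = (T - B) * Q := by
    have : (T - B) * (1 - Q) = 0 := by rw [sub_mul, hB, sub_self]
    rw [mul_sub, mul_one, sub_eq_zero] at this
    exact this
  have hfd := (finrank_biSup_eq_sum_of_iSupIndep
    (End.eigenspaces_iSupIndep (T : End ℂ X)) Λ hfin).1
  have hrank : Module.rank ℂ (LinearMap.range ((T - B : X →L[ℂ] X) : X →ₗ[ℂ] X)) ≤
      (n : Cardinal) := by
    rw [hTB]
    have h1 : LinearMap.range (Q : X →ₗ[ℂ] X) ≤ ⨆ a ∈ Λ, End.eigenspace (T : End ℂ X) a := by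
      rintro _ ⟨x, rfl⟩
      rw [ContinuousLinearMap.coe_coe, hQ, sum_apply]
      exact Submodule.sum_mem_biSup fun a ha => (hP a ha).1 x
    calc Module.rank ℂ (LinearMap.range (((T - B) * Q : X →L[ℂ] X) : X →ₗ[ℂ] X))
        ≤ Module.rank ℂ (LinearMap.range (Q : X →ₗ[ℂ] X)) :=
          LinearMap.rank_comp_le_right (Q : X →ₗ[ℂ] X) ((T - B : X →L[ℂ] X) : X →ₗ[ℂ] X)
      _ ≤ Module.rank ℂ (⨆ a ∈ Λ, End.eigenspace (T : End ℂ X) a : Submodule ℂ X) :=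
          Submodule.rank_mono h1
      _ ≤ n := by
          rw [← finrank_eq_rank]
          exact_mod_cast hn
  calc approxNumber T n ≤ ‖T - (T - B)‖ :=
        csInf_le ⟨0, by rintro _ ⟨A, -, rfl⟩; exact norm_nonneg _⟩ ⟨T - B, hrank, rfl⟩
    _ = ‖B‖ := by rw [sub_sub_cancel]
    _ ≤ 2 * C * ρ := hH.norm_contourTruncation_le hC hρ

end Approximation

section Enumeration

open Module

variable {X Y : Type*} [NormedAddCommGroup X] [NormedSpace ℂ X]
  [NormedAddCommGroup Y] [NormedSpace ℂ Y] {C : ℝ} {lam : ℕ → ℂ}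

theorem approxNumber_nonneg (T : X →L[ℂ] Y) (n : ℕ) : 0 ≤ approxNumber T n :=
  Real.sInf_nonneg (by rintro _ ⟨A, -, rfl⟩; exact norm_nonneg _)

theorem kolmogorovDiameter_nonneg (T : X →L[ℂ] X) (n : ℕ) : 0 ≤ kolmogorovDiameter T n :=
  Real.sInf_nonneg (by rintro _ ⟨G, -, rfl⟩; exact ContinuousLinearMap.opNorm_nonneg _)

theorem kolmogorovDiameter_le (T : X →L[ℂ] X) {n : ℕ} {G : Submodule ℂ X}
    (hG : Module.rank ℂ G ≤ (n : Cardinal)) :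
    kolmogorovDiameter T n ≤ ‖(quotMapL G).comp T‖ :=
  csInf_le ⟨0, by rintro _ ⟨G, -, rfl⟩; exact ContinuousLinearMap.opNorm_nonneg _⟩ ⟨G, hG, rfl⟩

theorem kolmogorovDiameter_le_approxNumber (T : X →L[ℂ] X) (n : ℕ) :
    kolmogorovDiameter T n ≤ approxNumber T n := by
  refine le_csInf ⟨_, 0, by simp, rfl⟩ ?_
  rintro _ ⟨A, hA, rfl⟩
  refine (kolmogorovDiameter_le T hA).trans ?_
  set G := LinearMap.range (A : X →ₗ[ℂ] X)
  refine ContinuousLinearMap.opNorm_le_bound _ (norm_nonneg _) fun x => ?_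
  have h : (quotMapL G).comp T x = G.mkQ ((T - A) x) := by
    have h1 : G.mkQ (A x) = 0 := (Submodule.Quotient.mk_eq_zero G).2 ⟨x, rfl⟩
    rw [sub_apply, map_sub, h1, sub_zero]
    rfl
  rw [h]
  exact (Submodule.Quotient.norm_mk_le G _).trans ((T - A).le_opNorm x)

variable {T : X →L[ℂ] X}

theorem IsEigenvalueEnumeration.antitone (hlam : IsEigenvalueEnumeration T lam) :
    Antitone fun n => ‖lam n‖ :=
  antitone_nat_of_succ_le hlam.1

theorem IsEigenvalueEnumeration.ncard_eq (hlam : IsEigenvalueEnumeration T lam)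
    (hH : IsHOperator T C) {a : ℂ} (ha : a ≠ 0) :
    {n : ℕ | lam n = a}.ncard = finrank ℂ (End.eigenspace (T : End ℂ X) a) :=
  (hlam.2.2.1 a ha).2.trans (hH.algebraicMultiplicity_eq a)

theorem IsEigenvalueEnumeration.finiteDimensional_eigenspace
    (hlam : IsEigenvalueEnumeration T lam) (hH : IsHOperator T C) {n : ℕ} (hn : lam n ≠ 0) :
    FiniteDimensional ℂ (End.eigenspace (T : End ℂ X) (lam n)) := by
  refine FiniteDimensional.of_finrank_pos ?_
  rw [← hlam.ncard_eq hH hn, Set.ncard_pos (hlam.2.2.1 _ hn).1]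
  exact ⟨n, rfl⟩

theorem IsEigenvalueEnumeration.finrank_biSup_eq (hlam : IsEigenvalueEnumeration T lam)
    (hH : IsHOperator T C) {s : Finset ℕ} (hs : ∀ k ∈ s, lam k ≠ 0) :
    {k | lam k ∈ s.image lam}.Finite ∧
    finrank ℂ (⨆ a ∈ s.image lam, End.eigenspace (T : End ℂ X) a : Submodule ℂ X) =
      {k | lam k ∈ s.image lam}.ncard := by
  have hne : ∀ a ∈ s.image lam, a ≠ 0 := by
    simpa using hs
  have hunion : {k | lam k ∈ s.image lam} = ⋃ a ∈ s.image lam, {k | lam k = a} := by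
    ext k
    simp [eq_comm]
  have hfin : {k | lam k ∈ s.image lam}.Finite := by
    rw [hunion]
    exact (s.image lam).finite_toSet.biUnion fun a ha => (hlam.2.2.1 a (hne a ha)).1
  refine ⟨hfin, ?_⟩
  rw [(finrank_biSup_eq_sum_of_iSupIndep (End.eigenspaces_iSupIndep (T : End ℂ X)) _ ?_).2]
  · rw [Set.ncard_eq_toFinset_card _ hfin, Finset.card_eq_sum_card_fiberwise
      (f := lam) (t := s.image lam) (by intro k hk; simpa using hk)]
    refine Finset.sum_congr rfl fun a ha => ?_
    rw [← hlam.ncard_eq hH (hne a ha), ← Set.ncard_coe_finset]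
    congr 1
    ext k
    simp only [Finset.coe_filter, Set.Finite.mem_toFinset, Set.mem_ofPred_eq]
    exact ⟨fun h => ⟨h ▸ ha, h⟩, And.right⟩
  · intro a ha
    obtain ⟨k, hk, rfl⟩ := Finset.mem_image.1 ha
    exact hlam.finiteDimensional_eigenspace hH (hs k hk)

theorem IsEigenvalueEnumeration.approxNumber_le [CompleteSpace X]
    (hlam : IsEigenvalueEnumeration T lam) (hH : IsHOperator T C) (hC : 0 ≤ C)
    (hT : IsCompactOperator T) (n : ℕ) : approxNumber T n ≤ 2 * C * ‖lam n‖ := by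
  have key : ∀ ε > 0, ∃ ρ < ‖lam n‖ + ε, approxNumber T n ≤ 2 * C * ρ := by
    intro ε hε
    obtain ⟨ρ, ⟨hρ1, hρ2⟩, hρ3⟩ := ((Set.Ioo_infinite (lt_add_of_pos_right ‖lam n‖ hε)).sdiff
      ((Finset.range n).image fun k => ‖lam k‖).finite_toSet).nonempty
    have hρ : 0 < ρ := (norm_nonneg _).trans_lt hρ1
    have hlt {k : ℕ} (hk : ρ ≤ ‖lam k‖) : k < n := by
      by_contra! h
      exact absurd (hk.trans (hlam.antitone h)) (not_le.2 hρ1)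
    have hmem {k : ℕ} (hk : ρ ≤ ‖lam k‖) :
        k ∈ (Finset.range n).filter fun k => ρ < ‖lam k‖ := by
      refine Finset.mem_filter.2 ⟨Finset.mem_range.2 (hlt hk), hk.lt_of_ne fun h => hρ3 ?_⟩
      exact Finset.mem_coe.2 (Finset.mem_image.2 ⟨k, Finset.mem_range.2 (hlt hk), h.symm⟩)
    set s := (Finset.range n).filter fun k => ρ < ‖lam k‖
    have hs {k : ℕ} (hk : k ∈ s) : ρ < ‖lam k‖ := (Finset.mem_filter.1 hk).2
    have hs0 {k : ℕ} (hk : k ∈ s) : lam k ≠ 0 := norm_pos_iff.1 (hρ.trans (hs hk))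
    refine ⟨ρ, hρ2, hH.approxNumber_le hC hT hρ (Λ := s.image lam) ?_ ?_ ?_ ?_⟩
    · intro a ha
      obtain ⟨k, hk, rfl⟩ := Finset.mem_image.1 ha
      exact hs hk
    · intro z hz hzρ
      obtain ⟨k, rfl⟩ := hlam.2.2.2 z hz (norm_pos_iff.1 (hρ.trans_le hzρ))
      exact Finset.mem_image_of_mem lam (hmem hzρ)
    · intro a ha
      obtain ⟨k, hk, rfl⟩ := Finset.mem_image.1 ha
      exact hlam.finiteDimensional_eigenspace hH (hs0 hk)
    · rw [(hlam.finrank_biSup_eq hH fun k => hs0).2]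
      calc {k | lam k ∈ s.image lam}.ncard ≤ (Finset.range n : Set ℕ).ncard := by
            refine Set.ncard_le_ncard (fun k (hk : lam k ∈ s.image lam) => ?_)
              (Finset.finite_toSet _)
            obtain ⟨j, hj, hjk⟩ := Finset.mem_image.1 hk
            exact Finset.mem_coe.2 (Finset.mem_range.2 (hlt (hjk ▸ (hs hj).le)))
        _ = n := by rw [Set.ncard_coe_finset, Finset.card_range]
  have hlim : Filter.Tendsto (fun ε : ℝ => 2 * C * (‖lam n‖ + ε)) (nhdsWithin 0 (Set.Ioi 0))
      (nhds (2 * C * (‖lam n‖ + 0))) :=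
    ((continuous_const.mul (continuous_const.add continuous_id)).tendsto 0).mono_left
      nhdsWithin_le_nhds
  rw [add_zero] at hlim
  refine ge_of_tendsto hlim (Filter.eventually_of_mem self_mem_nhdsWithin fun ε hε => ?_)
  obtain ⟨ρ, hρ, h⟩ := key ε hε
  exact h.trans (by gcongr)

theorem IsEigenvalueEnumeration.norm_le_kolmogorovDiameter
    (hlam : IsEigenvalueEnumeration T lam) (hH : IsHOperator T C) (hC : 0 < C) (n : ℕ) :
    ‖lam (2 * n)‖ ≤ 80 * C * kolmogorovDiameter T n := by
  by_cases h0 : lam (2 * n) = 0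
  · rw [h0, norm_zero]
    have := kolmogorovDiameter_nonneg T n
    positivity
  have hr : 0 < ‖lam (2 * n)‖ := norm_pos_iff.2 h0
  have hs {k : ℕ} (hk : k ∈ Finset.range (2 * n + 1)) : ‖lam (2 * n)‖ ≤ ‖lam k‖ :=
    hlam.antitone (Nat.lt_succ_iff.1 (Finset.mem_range.1 hk))
  obtain ⟨hfin, hrank⟩ := hlam.finrank_biSup_eq hH
    fun k hk => norm_pos_iff.1 (hr.trans_le (hs hk))
  have h := hH.le_kolmogorovDiameter hC hr (n := n)
    (Λ := (Finset.range (2 * n + 1)).image lam) ?_ ?_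
  · rwa [div_le_iff₀' (by positivity)] at h
  · intro a ha
    obtain ⟨k, hk, rfl⟩ := Finset.mem_image.1 ha
    exact hs hk
  · rw [hrank]
    calc 2 * n < (Finset.range (2 * n + 1) : Set ℕ).ncard := by
          rw [Set.ncard_coe_finset, Finset.card_range]
          exact Nat.lt_succ_self _
      _ ≤ _ := Set.ncard_le_ncard (fun k hk => Finset.mem_image_of_mem lam hk) hfin

end Enumeration

section SequenceSpace

theorem MemEllMu.of_le_const_mul {μ : ℝ≥0∞} {c d : ℕ → ℝ} {K : ℝ} (hK : 0 ≤ K)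
    (hd : MemEllMu μ d) (h : ∀ n, |c n| ≤ K * |d n|) : MemEllMu μ c := by
  unfold MemEllMu at *
  split_ifs at * with hμ
  · obtain ⟨M, hM⟩ := hd
    exact ⟨K * M, fun n => (h n).trans (mul_le_mul_of_nonneg_left (hM n) hK)⟩
  · refine Summable.of_nonneg_of_le (fun n => by positivity) (fun n => ?_)
      (hd.mul_left (K ^ μ.toReal))
    rw [← Real.mul_rpow hK (abs_nonneg _)]
    exact Real.rpow_le_rpow (abs_nonneg _) (h n) ENNReal.toReal_nonneg

theorem MemEllMu.of_even_of_antitone {μ : ℝ≥0∞} {c : ℕ → ℝ} (hc0 : ∀ n, 0 ≤ c n)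
    (hc : Antitone c) (h : MemEllMu μ fun n => c (2 * n)) : MemEllMu μ c := by
  have hodd : MemEllMu μ fun n => c (2 * n + 1) :=
    h.of_le_const_mul zero_le_one fun n => by
      rw [one_mul, abs_of_nonneg (hc0 _), abs_of_nonneg (hc0 _)]
      exact hc (Nat.le_succ _)
  unfold MemEllMu at *
  split_ifs at * with hμ
  · exact ⟨c 0, fun n => by rw [abs_of_nonneg (hc0 n)]; exact hc (Nat.zero_le n)⟩
  · exact (HasSum.even_add_odd (f := fun n => |c n| ^ μ.toReal) h.hasSum hodd.hasSum).summable

end SequenceSpace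

/-- For a compact H-operator `T` on an infinite-dimensional complex Banach space and any
`0 < μ ≤ ∞`, the conditions `(|λ_n(T)|) ∈ ℓ_μ`, `(δ_n(T)) ∈ ℓ_μ` and `(α_n(T)) ∈ ℓ_μ`
are equivalent.  (Here `lam n = λ_{n+1}(T)`, `kolmogorovDiameter T n = δ_n(T)` and
`approxNumber T n = α_{n+1}(T)`.) -/
theorem eigenvalue_kolmogorov_approx_ellmu_equiv {X : Type*} [NormedAddCommGroup X]
    [NormedSpace ℂ X] [CompleteSpace X] (hX : ¬ FiniteDimensional ℂ X)
    (T : X →L[ℂ] X) (C : ℝ) (hC : 1 ≤ C) (hH : IsHOperator T C)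
    (hT : IsCompactOperator T) (lam : ℕ → ℂ) (hlam : IsEigenvalueEnumeration T lam)
    (μ : ℝ≥0∞) (hμ : 0 < μ) :
    (MemEllMu μ (fun n => ‖lam n‖) ↔
      MemEllMu μ (fun n => kolmogorovDiameter T n)) ∧
    (MemEllMu μ (fun n => kolmogorovDiameter T n) ↔
      MemEllMu μ (fun n => approxNumber T n)) := by
  have hC0 : 0 < C := zero_lt_one.trans_le hC
  have lam_to_approx (h : MemEllMu μ fun n => ‖lam n‖) : MemEllMu μ fun n => approxNumber T n :=
    h.of_le_const_mul (K := 2 * C) (by positivity) fun n => by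
      rw [abs_of_nonneg (approxNumber_nonneg T n), abs_norm]
      exact hlam.approxNumber_le hH hC0.le hT n
  have approx_to_kolmogorov (h : MemEllMu μ fun n => approxNumber T n) :
      MemEllMu μ fun n => kolmogorovDiameter T n :=
    h.of_le_const_mul zero_le_one fun n => by
      rw [abs_of_nonneg (kolmogorovDiameter_nonneg T n), abs_of_nonneg (approxNumber_nonneg T n),
        one_mul]
      exact kolmogorovDiameter_le_approxNumber T n
  have kolmogorov_to_lam (h : MemEllMu μ fun n => kolmogorovDiameter T n) :
      MemEllMu μ fun n => ‖lam n‖ :=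
    MemEllMu.of_even_of_antitone (fun n => norm_nonneg _) hlam.antitone <|
      h.of_le_const_mul (K := 80 * C) (by positivity) fun n => by
        rw [abs_of_nonneg (kolmogorovDiameter_nonneg T n), abs_norm]
        exact hlam.norm_le_kolmogorovDiameter hH hC0 n
  exact ⟨⟨fun h => approx_to_kolmogorov (lam_to_approx h), kolmogorov_to_lam⟩,
    fun h => lam_to_approx (kolmogorov_to_lam h), approx_to_kolmogorov⟩
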